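/- Let K ≥ 1 and let φ, ψ, s₀, s₁ satisfy conditions (i)–(iv). Let F_K : D → [0,+∞] be Lebesgue measurable and let 𝓕_K be a family of K-quasinearly subharmonic functions u : D → [-∞,+∞) such that u(x) ≤ F_K(x) for all x ∈ D. If for each compact set E ⊂ D one has ∫_E ψ(F_K(x)) dm_n(x) < +∞, then the family 𝓕_K is locally uniformly bounded in D, and the function w*(x) := limsup_{y→x} w(y), where w(x) := sup_{u ∈ 𝓕_K} u⁺(x), is a K-quasinearly subharmonic function on D (with finite values). -/

import Mathlib

open MeasureTheory Metric Filter Set ENNReal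

noncomputable section

/-- The positive part of an extended real number, as an element of `ℝ≥0∞`. -/
def erealPos (x : EReal) : ℝ≥0∞ := if x = ⊤ then ⊤ else ENNReal.ofReal x.toReal

/-- `ν_n`, the Lebesgue measure of the unit ball of `ℝⁿ`. -/
def nuBall (n : ℕ) : ℝ := (volume (Metric.ball (0 : EuclideanSpace ℝ (Fin n)) 1)).toReal

/-- The (upper) integral `∫_A u dm_n` of an `EReal`-valued function, defined as the
lintegral of the positive part minus the lintegral of the negative part (an `EReal`). -/
def erealIntegralOn {n : ℕ} (A : Set (EuclideanSpace ℝ (Fin n)))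
    (u : EuclideanSpace ℝ (Fin n) → EReal) : EReal :=
  ((∫⁻ y in A, erealPos (u y) : ℝ≥0∞) : EReal) - ((∫⁻ y in A, erealPos (-(u y)) : ℝ≥0∞) : EReal)

/-- `u⁺ ∈ L¹_loc(D)`: the positive part of `u` has finite integral over every
compact subset of `D`. -/
def PosPartLocInt {n : ℕ} (u : EuclideanSpace ℝ (Fin n) → EReal)
    (D : Set (EuclideanSpace ℝ (Fin n))) : Prop :=
  ∀ E ⊆ D, IsCompact E → ∫⁻ x in E, erealPos (u x) < ⊤

/-- `u : D → [-∞, +∞)` is subharmonic on `D`: upper semicontinuous on `D`, never `+∞` on `D`,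
and satisfying the sub-mean-value inequality on every closed ball contained in `D`.
(The function `≡ -∞` satisfies this definition.) -/
def SubharmonicOn {n : ℕ} (u : EuclideanSpace ℝ (Fin n) → EReal)
    (D : Set (EuclideanSpace ℝ (Fin n))) : Prop :=
  UpperSemicontinuousOn u D ∧ (∀ x ∈ D, u x < ⊤) ∧
  ∀ x r, 0 < r → closedBall x r ⊆ D →
    u x ≤ ((1 / (nuBall n * r ^ n) : ℝ) : EReal) * erealIntegralOn (ball x r) u

/-- `u : D → [-∞, +∞)` is nearly subharmonic on `D`. -/
def NearlySubharmonicOn {n : ℕ} (u : EuclideanSpace ℝ (Fin n) → EReal)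
    (D : Set (EuclideanSpace ℝ (Fin n))) : Prop :=
  Measurable (D.restrict u) ∧ (∀ x ∈ D, u x < ⊤) ∧ PosPartLocInt u D ∧
  ∀ x r, 0 < r → closedBall x r ⊆ D →
    u x ≤ ((1 / (nuBall n * r ^ n) : ℝ) : EReal) * erealIntegralOn (ball x r) u

/-- `u : D → [-∞, +∞)` is `K`-quasinearly subharmonic on `D`:
Lebesgue measurable, `u⁺ ∈ L¹_loc(D)`, and for every `M ≥ 0` the function
`u_M := max {u, -M} + M` satisfies the generalized sub-mean-value inequality with constant `K`
on every closed ball contained in `D`. -/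
def QNSubharmonicOn {n : ℕ} (K : ℝ) (u : EuclideanSpace ℝ (Fin n) → EReal)
    (D : Set (EuclideanSpace ℝ (Fin n))) : Prop :=
  Measurable (D.restrict u) ∧ (∀ x ∈ D, u x < ⊤) ∧ PosPartLocInt u D ∧
  ∀ M : ℝ, 0 ≤ M → ∀ x r, 0 < r → closedBall x r ⊆ D →
    erealPos ((u x ⊔ ((-M : ℝ) : EReal)) + ((M : ℝ) : EReal)) ≤
      ENNReal.ofReal (K / (nuBall n * r ^ n)) *
        ∫⁻ y in ball x r, erealPos ((u y ⊔ ((-M : ℝ) : EReal)) + ((M : ℝ) : EReal))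

/-- `u : D → [-∞, +∞)` is `K`-quasinearly subharmonic n.s. (in the narrow sense) on `D`. -/
def QNSubharmonicNSOn {n : ℕ} (K : ℝ) (u : EuclideanSpace ℝ (Fin n) → EReal)
    (D : Set (EuclideanSpace ℝ (Fin n))) : Prop :=
  Measurable (D.restrict u) ∧ (∀ x ∈ D, u x < ⊤) ∧ PosPartLocInt u D ∧
  ∀ x r, 0 < r → closedBall x r ⊆ D →
    u x ≤ ((K / (nuBall n * r ^ n) : ℝ) : EReal) * erealIntegralOn (ball x r) u

/-- `log⁺` on `[0, +∞]`. -/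
def logPlusE (t : ℝ≥0∞) : ℝ≥0∞ := if t = ⊤ then ⊤ else ENNReal.ofReal (Real.log t.toReal)

section MeanValue

variable {n : ℕ}

lemma erealPos_eq_toENNReal (a : EReal) : erealPos a = a.toENNReal := rfl

lemma erealPos_le_iff {a : EReal} {q : ℝ≥0∞} : erealPos a ≤ q ↔ a ≤ (q : EReal) := by
  rw [erealPos_eq_toENNReal, ← EReal.coe_ennreal_le_coe_ennreal_iff, EReal.coe_toENNReal_eq_max]
  simpa using fun _ => EReal.coe_ennreal_nonneg q

lemma erealPos_sup_neg_add {a : EReal} {M : ℝ} :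
    erealPos ((a ⊔ ((-M : ℝ) : EReal)) + (M : EReal)) = erealPos (a + (M : EReal)) := by
  refine eq_of_forall_ge_iff fun q => ?_
  rw [erealPos_le_iff, erealPos_le_iff]
  rcases le_total a ((-M : ℝ) : EReal) with h | h
  · have h0 : ((-M : ℝ) : EReal) + (M : EReal) = 0 := by
      rw [← EReal.coe_add]; simp
    have h1 : a + (M : EReal) ≤ 0 := (add_le_add_left h _).trans_eq h0
    rw [sup_eq_right.2 h, h0]
    exact ⟨fun _ => h1.trans (EReal.coe_ennreal_nonneg q), fun _ => EReal.coe_ennreal_nonneg q⟩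
  · rw [sup_eq_left.2 h]

lemma erealPos_sup_neg_add_le_iff {a : EReal} {M : ℝ} {q : ℝ≥0∞} :
    erealPos ((a ⊔ ((-M : ℝ) : EReal)) + (M : EReal)) ≤ q ↔ a ≤ (q : EReal) - (M : EReal) := by
  rw [erealPos_sup_neg_add, erealPos_le_iff, EReal.le_sub_iff_add_le] <;> simp

lemma nuBall_pos : 0 < nuBall n :=
  ENNReal.toReal_pos (measure_ball_pos _ _ one_pos).ne' measure_ball_lt_top.ne

lemma volume_ball_eq_ofReal (x : EuclideanSpace ℝ (Fin n)) {r : ℝ} (hr : 0 < r) :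
    volume (ball x r) = ENNReal.ofReal (nuBall n * r ^ n) := by
  rw [Measure.addHaar_ball_of_pos _ _ hr, mul_comm, ENNReal.ofReal_mul nuBall_pos.le, nuBall,
    ENNReal.ofReal_toReal measure_ball_lt_top.ne, finrank_euclideanSpace_fin]

lemma ofReal_div_mul_volume_ball (x : EuclideanSpace ℝ (Fin n)) {r : ℝ} (hr : 0 < r) {K : ℝ}
    (hK : 0 ≤ K) :
    ENNReal.ofReal (K / (nuBall n * r ^ n)) * volume (ball x r) = ENNReal.ofReal K := by
  have : 0 < nuBall n * r ^ n := mul_pos nuBall_pos (pow_pos hr n)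
  rw [volume_ball_eq_ofReal x hr, ← ENNReal.ofReal_mul (by positivity), div_mul_cancel₀ _ this.ne']

/-- A function satisfying the `K`-mean value inequality which exceeds `t` at the centre of a ball
exceeds a larger level `b` somewhere in the ball, provided the set where it takes
intermediate values is small. -/
lemma exists_lt_of_mean_value {K : ℝ} (hK : 0 ≤ K) {v : EuclideanSpace ℝ (Fin n) → ℝ≥0∞}
    {x : EuclideanSpace ℝ (Fin n)} {r : ℝ} (hr : 0 < r)
    (hmv : v x ≤ ENNReal.ofReal (K / (nuBall n * r ^ n)) * ∫⁻ y in ball x r, v y)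
    {a t b C : ℝ≥0∞} (hat : ENNReal.ofReal (2 * K) * a ≤ t) (hbt : b ≤ C * t)
    (hvol : ENNReal.ofReal (2 * K) * C * volume (ball x r ∩ {y | a < v y ∧ v y ≤ b}) ≤
      volume (ball x r))
    (htx : t < v x) : ∃ y ∈ ball x r, b < v y := by
  by_contra! hb
  set A := ball x r ∩ {y | a < v y ∧ v y ≤ b} with hA
  set c := ENNReal.ofReal (K / (nuBall n * r ^ n)) with hc
  have hcvol : c * volume (ball x r) = ENNReal.ofReal K := ofReal_div_mul_volume_ball x hr hK
  have hI : ∫⁻ y in ball x r, v y ≤ a * volume (ball x r) + b * volume A := by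
    calc ∫⁻ y in ball x r, v y ≤ ∫⁻ y in ball x r, (a + A.indicator (fun _ => b) y) := by
          refine setLIntegral_mono' measurableSet_ball fun y hy => ?_
          by_cases hay : a < v y
          · rw [indicator_of_mem (show y ∈ A from ⟨hy, hay, hb y hy⟩)]
            exact (hb y hy).trans le_add_self
          · exact (not_lt.1 hay).trans le_self_add
      _ = (∫⁻ y in ball x r, a) + ∫⁻ y in ball x r, A.indicator (fun _ => b) y :=
          lintegral_add_left measurable_const _
      _ ≤ a * volume (ball x r) + b * volume A := by
          rw [setLIntegral_const]
          gcongr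
          exact (lintegral_indicator_const_le _ _).trans
            (by gcongr; exact Measure.restrict_le_self)
  have h2 : ENNReal.ofReal (2 * K) = 2 * ENNReal.ofReal K := by
    rw [ENNReal.ofReal_mul zero_le_two]; simp
  have hv0 : volume (ball x r) ≠ 0 := (measure_ball_pos _ _ hr).ne'
  have hv1 : volume (ball x r) ≠ ⊤ := measure_ball_lt_top.ne
  have hsmall : 2 * c * (C * volume A) ≤ 1 := by
    rw [← ENNReal.mul_le_mul_iff_right hv0 hv1]
    calc volume (ball x r) * (2 * c * (C * volume A))
        = 2 * (c * volume (ball x r)) * C * volume A := by ring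
      _ ≤ volume (ball x r) * 1 := by rwa [hcvol, ← h2, mul_one]
  have : 2 * v x ≤ 2 * t := by
    calc 2 * v x ≤ 2 * (c * (a * volume (ball x r) + b * volume A)) := by
          gcongr; exact hmv.trans (by gcongr)
      _ = 2 * (c * volume (ball x r)) * a + 2 * c * (b * volume A) := by ring
      _ ≤ t + 2 * c * ((C * t) * volume A) := by
          rw [hcvol, ← h2]; gcongr
      _ = t + (2 * c * (C * volume A)) * t := by ring
      _ ≤ t + 1 * t := by gcongr
      _ = 2 * t := by ring
  exact absurd htx (not_lt.2 ((ENNReal.mul_le_mul_iff_right two_ne_zero ofNat_ne_top).1 this))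

end MeanValue

section Domination

variable {n : ℕ}

lemma holderConjugate_natCast (hn : 2 ≤ n) : (n : ℝ).HolderConjugate (n / (n - 1)) := by
  have h : (1 : ℝ) < n := by exact_mod_cast hn
  exact Real.HolderConjugate.conjExponent h

/-- Hölder's inequality with weights: a sum of `n`-th roots. -/
lemma sum_rpow_inv_le (hn : 2 ≤ n) (Φ a : ℕ → ℝ≥0∞) (hΦ0 : ∀ k, Φ k ≠ 0) (hΦ1 : ∀ k, Φ k ≠ ⊤)
    (S : Finset ℕ) :
    ∑ k ∈ S, a k ^ (1 / (n : ℝ)) ≤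
      (∑ k ∈ S, Φ k * a k) ^ (1 / (n : ℝ)) *
        (∑ k ∈ S, (Φ k ^ (1 / ((n : ℝ) - 1)))⁻¹) ^ (1 / ((n : ℝ) / (n - 1))) := by
  have hn1 : (1 : ℝ) < n := by exact_mod_cast hn
  have hn0 : (n : ℝ) ≠ 0 := by positivity
  have hn2 : (n : ℝ) - 1 ≠ 0 := by linarith
  have h := ENNReal.inner_le_Lp_mul_Lq S (fun k => (Φ k * a k) ^ (1 / (n : ℝ)))
    (fun k => (Φ k ^ (1 / (n : ℝ)))⁻¹) (holderConjugate_natCast hn)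
  convert h using 1
  · refine Finset.sum_congr rfl fun k _ => ?_
    rw [ENNReal.mul_rpow_of_nonneg _ _ (by positivity), mul_comm, ← mul_assoc,
      ENNReal.inv_mul_cancel, one_mul]
    · exact (ENNReal.rpow_pos (pos_iff_ne_zero.2 (hΦ0 k)) (hΦ1 k)).ne'
    · exact ENNReal.rpow_ne_top_of_nonneg (by positivity) (hΦ1 k)
  · congr 2
    · refine Finset.sum_congr rfl fun k _ => ?_
      rw [← ENNReal.rpow_mul, one_div_mul_cancel hn0, ENNReal.rpow_one]
    · refine Finset.sum_congr rfl fun k _ => ?_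
      rw [ENNReal.inv_rpow, ← ENNReal.rpow_mul]
      congr 2
      field_simp

/-- The layers `{τ k < v ≤ τ (k + l + 1)}` overlap at most `l + 1` times, which bounds the
weighted sum of their measures. -/
lemma tsum_mul_measure_layer_le {α : Type*} [MeasurableSpace α] (μ : Measure α) {B : Set α}
    (hB : MeasurableSet B) {v g : α → ℝ≥0∞} (hv : Measurable (B.domRestrict v)) {τ Φ : ℕ → ℝ≥0∞}
    (hτ : Monotone τ) (hΦ : Monotone Φ) (hg : ∀ x ∈ B, ∀ k, τ k < v x → Φ k ≤ g x) (l : ℕ) :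
    ∑' k, Φ k * μ (B ∩ {y | τ k < v y ∧ v y ≤ τ (k + l + 1)}) ≤
      (l + 1 : ℕ) * ∫⁻ y in B, g y ∂μ := by
  set L : ℕ → Set α := fun k => B ∩ {y | τ k < v y ∧ v y ≤ τ (k + 1)} with hL
  have hLmeas : ∀ k, MeasurableSet (L k) := fun k => by
    have : MeasurableSet ((B.domRestrict v) ⁻¹' Ioc (τ k) (τ (k + 1))) := hv measurableSet_Ioc
    convert hB.subtype_image this using 1
    ext y
    simp only [hL, mem_inter_iff, mem_ofPred_eq, mem_image, mem_preimage, Subtype.exists]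
    simp [and_left_comm]
  have hLdisj : Pairwise (Function.onFun Disjoint L) := by
    refine (pairwise_disjoint_on L).2 fun i j hij => Set.disjoint_left.2 fun y hi hj => ?_
    exact absurd (hj.2.1.trans_le hi.2.2) (not_lt.2 (hτ hij))
  have hsum : ∑' k, Φ k * μ (L k) ≤ ∫⁻ y in B, g y ∂μ := by
    calc ∑' k, Φ k * μ (L k) ≤ ∑' k, ∫⁻ y in L k, g y ∂μ := by
          refine ENNReal.tsum_le_tsum fun k => ?_
          rw [← setLIntegral_const]
          exact setLIntegral_mono' (hLmeas k) fun y hy => hg y hy.1 k hy.2.1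
      _ = ∫⁻ y in ⋃ k, L k, g y ∂μ := (lintegral_iUnion hLmeas hLdisj g).symm
      _ ≤ ∫⁻ y in B, g y ∂μ := lintegral_mono_set (iUnion_subset fun k => inter_subset_left)
  have hcover : ∀ k m, {y | τ k < v y ∧ v y ≤ τ (k + m)} ∩ B ⊆
      ⋃ j ∈ Finset.range m, L (k + j) := by
    intro k m
    induction m with
    | zero => rintro y ⟨⟨h1, h2⟩, -⟩; exact absurd (h1.trans_le h2) (lt_irrefl _)
    | succ m ih =>
      rintro y ⟨⟨h1, h2⟩, hy⟩
      rw [Finset.range_add_one, Finset.set_biUnion_insert]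
      rcases le_or_gt (v y) (τ (k + m)) with h | h
      · exact Or.inr (ih ⟨⟨h1, h⟩, hy⟩)
      · exact Or.inl ⟨hy, h, h2⟩
  calc ∑' k, Φ k * μ (B ∩ {y | τ k < v y ∧ v y ≤ τ (k + l + 1)})
      ≤ ∑' k, ∑ j ∈ Finset.range (l + 1), Φ (k + j) * μ (L (k + j)) := by
        refine ENNReal.tsum_le_tsum fun k => ?_
        calc _ ≤ Φ k * ∑ j ∈ Finset.range (l + 1), μ (L (k + j)) := by
              gcongr
              rw [inter_comm]
              exact (measure_mono (hcover k (l + 1))).trans (measure_biUnion_finset_le _ _)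
          _ ≤ _ := by
              rw [Finset.mul_sum]
              gcongr with j _
              exact hΦ (Nat.le_add_right k j)
    _ = ∑ j ∈ Finset.range (l + 1), ∑' k, Φ (k + j) * μ (L (k + j)) :=
        Summable.tsum_finsetSum fun _ _ => ENNReal.summable
    _ ≤ ∑ j ∈ Finset.range (l + 1), ∫⁻ y in B, g y ∂μ := by
        refine Finset.sum_le_sum fun j _ => le_trans ?_ hsum
        exact ENNReal.tsum_comp_le_tsum_of_injective (add_left_injective j)
          (fun k => Φ k * μ (L k))
    _ = _ := by simp

/-- Functions satisfying the `K`-mean value inequality in a ball and dominated by a common function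
`g` through levels `τ` and weights `Φ` are uniformly bounded near the centre. -/
theorem exists_forall_le_of_domination (hn : 2 ≤ n) {K : ℝ} (hK : 0 ≤ K) {τ Φ : ℕ → ℝ≥0∞} {l : ℕ}
    {C : ℝ≥0∞} (hC : C ≠ ⊤) (hτ : Monotone τ) (hτ_unbdd : ∀ b : ℝ≥0∞, b ≠ ⊤ → ∃ k, b < τ k)
    (hΦ : Monotone Φ) (hΦ0 : ∀ k, Φ k ≠ 0) (hΦ1 : ∀ k, Φ k ≠ ⊤)
    (hsum : ∑' k, (Φ k ^ (1 / ((n : ℝ) - 1)))⁻¹ ≠ ⊤)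
    (hdouble : ∀ k, ENNReal.ofReal (2 * K) * τ k ≤ τ (k + l))
    (hgrowth : ∀ k, τ (k + l + 1) ≤ C * τ (k + l))
    {x₀ : EuclideanSpace ℝ (Fin n)} {r : ℝ} (hr : 0 < r) {g : EuclideanSpace ℝ (Fin n) → ℝ≥0∞}
    (hg : ∫⁻ y in closedBall x₀ (3 * r), g y ≠ ⊤) :
    ∃ m, ∀ v : EuclideanSpace ℝ (Fin n) → ℝ≥0∞,
      Measurable ((closedBall x₀ (3 * r)).domRestrict v) →
      (∀ x ∈ closedBall x₀ (3 * r), ∀ k, τ k < v x → Φ k ≤ g x) →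
      ∫⁻ y in closedBall x₀ (3 * r), v y ≠ ⊤ →
      (∀ x ρ, 0 < ρ → closedBall x ρ ⊆ closedBall x₀ (3 * r) →
        v x ≤ ENNReal.ofReal (K / (nuBall n * ρ ^ n)) * ∫⁻ y in ball x ρ, v y) →
      ∀ y ∈ closedBall x₀ r, v y ≤ τ m := by
  have hn1 : (1 : ℝ) < n := by exact_mod_cast hn
  have hn0 : n ≠ 0 := by omega
  set B := closedBall x₀ (3 * r) with hB
  set ν := ENNReal.ofReal (nuBall n) with hν
  have hν0 : ν ≠ 0 := (ENNReal.ofReal_pos.2 nuBall_pos).ne'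
  set α : ℝ≥0∞ := ENNReal.ofReal (2 * K) * C / ν with hα
  have hα1 : α ≠ ⊤ :=
    ENNReal.div_ne_top (ENNReal.mul_ne_top ENNReal.ofReal_ne_top hC) hν0
  set e : ℝ := 1 / ((n : ℝ) / (n - 1)) with he
  have he0 : 0 < e := by
    have : 0 < (n : ℝ) - 1 := by linarith
    positivity
  set Q : ℝ≥0∞ := (α * ((l + 1 : ℕ) * ∫⁻ y in B, g y)) ^ (1 / (n : ℝ)) with hQ
  have hQ1 : Q ≠ ⊤ := ENNReal.rpow_ne_top_of_nonneg (by positivity)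
    (ENNReal.mul_ne_top hα1 (ENNReal.mul_ne_top (ENNReal.natCast_ne_top _) hg))
  have hgeom : ∑' k : ℕ, (2⁻¹ : ℝ≥0∞) ^ k ≠ ⊤ := by
    rw [ENNReal.tsum_geometric, ENNReal.one_sub_inv_two, inv_inv]
    exact ENNReal.ofNat_ne_top
  have hlim : Tendsto (fun m : ℕ => Q * (∑' k, (Φ (k + m) ^ (1 / ((n : ℝ) - 1)))⁻¹) ^ e +
      ∑' k, (2⁻¹ : ℝ≥0∞) ^ (k + m)) atTop (nhds 0) := by
    have h1 := ENNReal.tendsto_sum_nat_add _ hsum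
    have h2 := ENNReal.tendsto_sum_nat_add _ hgeom
    have h3 := ENNReal.Tendsto.const_mul (a := Q)
      ((ENNReal.continuous_rpow_const (y := e)).tendsto 0 |>.comp h1) (Or.inr hQ1)
    simpa [ENNReal.zero_rpow_of_pos he0] using h3.add h2
  obtain ⟨m, hm⟩ := (hlim.eventually_le_const (ENNReal.ofReal_pos.2 hr)).exists
  refine ⟨m + l, fun v hv hvg hvint hmv y₀ hy₀ => ?_⟩
  by_contra! hlt
  set A : ℕ → Set (EuclideanSpace ℝ (Fin n)) :=
    fun k => B ∩ {y | τ k < v y ∧ v y ≤ τ (k + l + 1)} with hA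
  set ρ : ℕ → ℝ≥0∞ := fun k => (α * volume (A k)) ^ (1 / (n : ℝ)) + 2⁻¹ ^ k with hρ
  have hAtop : ∀ k, volume (A k) ≠ ⊤ := fun k =>
    ((measure_mono inter_subset_left).trans_lt measure_closedBall_lt_top).ne
  have hρtop : ∀ k, ρ k ≠ ⊤ := fun k => ENNReal.add_ne_top.2
    ⟨ENNReal.rpow_ne_top_of_nonneg (by positivity) (ENNReal.mul_ne_top hα1 (hAtop k)),
      ENNReal.pow_ne_top (by simp)⟩
  have hρ0 : ∀ k, ρ k ≠ 0 := fun k => by simp [hρ]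
  have hlayers := tsum_mul_measure_layer_le volume measurableSet_closedBall hv hτ hΦ hvg l
  have hρsum : ∀ N, ∑ j ∈ Finset.range N, ρ (j + m) ≤ ENNReal.ofReal r := fun N => by
    refine le_trans ?_ hm
    rw [Finset.sum_add_distrib]
    gcongr ?_ + ?_
    · refine (sum_rpow_inv_le hn (fun j => Φ (j + m)) (fun j => α * volume (A (j + m)))
        (fun _ => hΦ0 _) (fun _ => hΦ1 _) _).trans ?_
      refine mul_le_mul' (ENNReal.rpow_le_rpow ?_ (by positivity))
        (ENNReal.rpow_le_rpow ?_ he0.le)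
      · calc ∑ j ∈ Finset.range N, Φ (j + m) * (α * volume (A (j + m)))
            = α * ∑ j ∈ Finset.range N, Φ (j + m) * volume (A (j + m)) := by
              rw [Finset.mul_sum]
              exact Finset.sum_congr rfl fun _ _ => by ring
          _ ≤ α * ∑' j, Φ (j + m) * volume (A (j + m)) := by
              gcongr
              exact ENNReal.sum_le_tsum _
          _ ≤ _ := by
              gcongr
              exact (ENNReal.tsum_comp_le_tsum_of_injective (add_left_injective m)
                (fun k => Φ k * volume (A k))).trans hlayers
      · exact ENNReal.sum_le_tsum _
    · exact ENNReal.sum_le_tsum _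
  have hchain : ∀ N, ∃ y, τ (N + m + l) < v y ∧
      edist y y₀ ≤ ∑ j ∈ Finset.range N, ρ (j + m) := by
    intro N
    induction N with
    | zero => exact ⟨y₀, by simpa using hlt, by simp⟩
    | succ N ih =>
      obtain ⟨y, hy, hyd⟩ := ih
      set R := (ρ (N + m)).toReal with hR
      have hR0 : 0 < R := ENNReal.toReal_pos (hρ0 _) (hρtop _)
      have hofR : ENNReal.ofReal R = ρ (N + m) := ENNReal.ofReal_toReal (hρtop _)
      have hRB : closedBall y R ⊆ B := by
        intro z hz
        have h1 : edist z y₀ ≤ ENNReal.ofReal r := by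
          refine le_trans ?_ (hρsum (N + 1))
          rw [Finset.sum_range_succ, add_comm, ← hofR]
          refine (edist_triangle z y y₀).trans (add_le_add ?_ hyd)
          rw [edist_dist]
          exact ENNReal.ofReal_le_ofReal hz
        rw [edist_dist, ENNReal.ofReal_le_ofReal_iff hr.le] at h1
        rw [hB, mem_closedBall]
        rw [mem_closedBall] at hy₀
        linarith [dist_triangle z y₀ x₀]
      have hvol : ENNReal.ofReal (2 * K) * C * volume (A (N + m)) ≤ volume (ball y R) := by
        have h1 : α * volume (A (N + m)) ≤ ρ (N + m) ^ n := by
          calc α * volume (A (N + m))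
              = ((α * volume (A (N + m))) ^ (1 / (n : ℝ))) ^ n := by
                rw [← ENNReal.rpow_natCast, ← ENNReal.rpow_mul, one_div_mul_cancel (by positivity),
                  ENNReal.rpow_one]
            _ ≤ ρ (N + m) ^ n := by
                gcongr
                exact le_self_add
        rw [volume_ball_eq_ofReal y hR0, ENNReal.ofReal_mul nuBall_pos.le,
          ENNReal.ofReal_pow hR0.le, hofR]
        calc ENNReal.ofReal (2 * K) * C * volume (A (N + m))
            = ν * (α * volume (A (N + m))) := by
              rw [← mul_assoc, hα, ENNReal.mul_div_cancel hν0 ENNReal.ofReal_ne_top]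
          _ ≤ ν * ρ (N + m) ^ n := by gcongr
      obtain ⟨z, hz, hzv⟩ := exists_lt_of_mean_value hK hR0 (hmv y R hR0 hRB)
        (hdouble (N + m)) (hgrowth (N + m)) (le_trans (by
          gcongr
          exact inter_subset_inter_left _ (ball_subset_closedBall.trans hRB)) hvol) hy
      refine ⟨z, by rwa [show N + 1 + m + l = N + m + l + 1 by ring], ?_⟩
      rw [Finset.sum_range_succ, add_comm, ← hofR]
      refine (edist_triangle z y y₀).trans (add_le_add ?_ hyd)
      rw [edist_dist]
      exact ENNReal.ofReal_le_ofReal (le_of_lt hz)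
  obtain ⟨k, hk⟩ := hτ_unbdd (ENNReal.ofReal (K / (nuBall n * r ^ n)) * ∫⁻ y in B, v y)
    (ENNReal.mul_ne_top ENNReal.ofReal_ne_top hvint)
  obtain ⟨y, hy, hyd⟩ := hchain k
  have hyr : dist y y₀ ≤ r := by
    have := hyd.trans (hρsum k)
    rwa [edist_dist, ENNReal.ofReal_le_ofReal_iff hr.le] at this
  have hyB : closedBall y r ⊆ B := by
    refine closedBall_subset_closedBall' ?_
    rw [mem_closedBall] at hy₀
    linarith [dist_triangle y y₀ x₀]
  refine absurd ((hmv y r hr hyB).trans ?_) (not_le.2 ((hk.trans_le (hτ ?_)).trans hy))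
  · gcongr
    exact ball_subset_closedBall.trans hyB
  · omega

end Domination

section Levels

lemma strictMonoOn_rightInverse {ψ ψinv : ℝ≥0∞ → ℝ≥0∞} {c : ℝ≥0∞} (hψ : Monotone ψ)
    (h : ∀ t, c ≤ t → ψ (ψinv t) = t) : StrictMonoOn ψinv (Ici c) := by
  intro a ha b hb hab
  by_contra! hle
  have := hψ hle
  rw [h a ha, h b hb] at this
  exact absurd hab (not_lt.2 this)

lemma map_top_of_rightInverse {ψ ψinv : ℝ≥0∞ → ℝ≥0∞} {c : ℝ≥0∞} (hψ : Monotone ψ)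
    (h : ∀ t, c ≤ t → ψ (ψinv t) = t) : ψ ⊤ = ⊤ :=
  top_le_iff.1 ((h ⊤ le_top).symm.le.trans (hψ le_top))

lemma map_ne_top_of_inverse {ψ ψinv : ℝ≥0∞ → ℝ≥0∞} {c : ℝ≥0∞} (hψ : Monotone ψ)
    (h : ∀ t, c ≤ t → ψ (ψinv t) = t ∧ ∀ s, ψ s = t → s = ψinv t) {s : ℝ≥0∞} (hs : s ≠ ⊤) :
    ψ s ≠ ⊤ := fun hs' =>
  hs (((h ⊤ le_top).2 s hs').trans
    ((h ⊤ le_top).2 ⊤ (map_top_of_rightInverse hψ fun t ht => (h t ht).1)).symm)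

/-- The levels `(ψ⁻¹ ∘ φ) k`, for large `k`, satisfy the assumptions of
`exists_forall_le_of_domination`. -/
lemma exists_levels {n : ℕ} (hn : 2 ≤ n) {K : ℝ} {φ ψ φinv ψinv : ℝ≥0∞ → ℝ≥0∞}
    (hφ : Monotone φ) (hψ : Monotone ψ) {s₀ s₁ : ℕ} (hs : s₀ < s₁)
    (hφinv : ∀ t : ℝ≥0∞, min (φ ((s₁ - s₀ : ℕ) : ℝ≥0∞)) (ψ ((s₁ - s₀ : ℕ) : ℝ≥0∞)) ≤ t →
      φ (φinv t) = t ∧ ∀ s, φ s = t → s = φinv t)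
    (hψinv : ∀ t : ℝ≥0∞, min (φ ((s₁ - s₀ : ℕ) : ℝ≥0∞)) (ψ ((s₁ - s₀ : ℕ) : ℝ≥0∞)) ≤ t →
      ψ (ψinv t) = t ∧ ∀ s, ψ s = t → s = ψinv t)
    (hii : ∀ s : ℝ, (s₁ : ℝ) ≤ s →
      ENNReal.ofReal (2 * K) * ψinv (φ (ENNReal.ofReal (s - (s₀ : ℝ)))) ≤
        ψinv (φ (ENNReal.ofReal s)))
    {C : ℝ≥0∞} (hiii : ∀ s : ℝ, (s₁ : ℝ) + 1 ≤ s →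
      ψinv (φ (ENNReal.ofReal (s + 1))) ≤ C * ψinv (φ (ENNReal.ofReal s)))
    (hiv : ∫⁻ s in Set.Ioi ((s₁ : ℝ)),
      (φ (ENNReal.ofReal (s - (s₀ : ℝ))) ^ (1 / ((n : ℝ) - 1)))⁻¹ < ⊤) :
    ∃ τ : ℕ → ℝ≥0∞, Monotone τ ∧ (∀ k, τ k ≠ ⊤) ∧ (∀ b : ℝ≥0∞, b ≠ ⊤ → ∃ k, b < τ k) ∧
      (∀ k, ψ (τ k) ≠ 0) ∧ ∑' k, (ψ (τ k) ^ (1 / ((n : ℝ) - 1)))⁻¹ ≠ ⊤ ∧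
      (∀ k, ENNReal.ofReal (2 * K) * τ k ≤ τ (k + s₀)) ∧
      ∀ k, τ (k + s₀ + 1) ≤ C * τ (k + s₀) := by
  set c := min (φ ((s₁ - s₀ : ℕ) : ℝ≥0∞)) (ψ ((s₁ - s₀ : ℕ) : ℝ≥0∞)) with hc
  set p := s₁ - s₀ + 1 with hp
  have hpp : p + s₀ = s₁ + 1 := by omega
  have hppR : (p : ℝ) + s₀ = s₁ + 1 := by exact_mod_cast hpp
  have hψ' : ∀ t, c ≤ t → ψ (ψinv t) = t := fun t ht => (hψinv t ht).1
  have hφ' : ∀ t, c ≤ t → φ (φinv t) = t := fun t ht => (hφinv t ht).1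
  have hlt : ∀ k : ℕ, ((s₁ - s₀ : ℕ) : ℝ≥0∞) < (p + k : ℕ) := fun k => by
    exact_mod_cast (by omega : s₁ - s₀ < p + k)
  have hcφ : ∀ k : ℕ, c ≤ φ (p + k : ℕ) := fun k => (min_le_left _ _).trans (hφ (hlt k).le)
  set τ : ℕ → ℝ≥0∞ := fun k => ψinv (φ (p + k : ℕ)) with hτ
  have hψτ : ∀ k, ψ (τ k) = φ (p + k : ℕ) := fun k => hψ' _ (hcφ k)
  have hφtop : ∀ k : ℕ, φ (p + k : ℕ) ≠ ⊤ := fun k =>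
    map_ne_top_of_inverse hφ hφinv (ENNReal.natCast_ne_top _)
  have hcast : ∀ k : ℕ, ENNReal.ofReal (((p + k : ℕ) : ℝ)) = (p + k : ℕ) := fun k =>
    ENNReal.ofReal_natCast _
  refine ⟨τ, ?_, ?_, ?_, ?_, ?_, ?_, ?_⟩
  · intro i j hij
    exact (strictMonoOn_rightInverse hψ hψ').monotoneOn (hcφ i) (hcφ j)
      (hφ (by exact_mod_cast Nat.add_le_add_left hij p))
  · intro k hk
    refine hφtop k ?_
    rw [← hψτ k, hk, map_top_of_rightInverse hψ hψ']
  · intro b hb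
    by_contra! hle
    have hφle : ∀ k : ℕ, φ (p + k : ℕ) ≤ ψ b := fun k => (hψτ k).symm.le.trans (hψ (hle k))
    have hb' : ψ b ≠ ⊤ := map_ne_top_of_inverse hψ hψinv hb
    have hcb : c ≤ ψ b + 1 := ((hcφ 0).trans (hφle 0)).trans le_self_add
    have hfin : φinv (ψ b + 1) ≠ ⊤ := by
      intro h
      have := hφ' _ hcb
      rw [h, map_top_of_rightInverse hφ hφ'] at this
      exact ENNReal.add_ne_top.2 ⟨hb', ENNReal.one_ne_top⟩ this.symm
    obtain ⟨k, hk⟩ := ENNReal.exists_nat_gt hfin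
    have h1 : ψ b + 1 ≤ ψ b := by
      calc ψ b + 1 = φ (φinv (ψ b + 1)) := (hφ' _ hcb).symm
        _ ≤ φ (p + k : ℕ) := hφ (hk.le.trans (by exact_mod_cast Nat.le_add_left k p))
        _ ≤ ψ b := hφle k
    exact absurd (ENNReal.lt_add_right hb' one_ne_zero) (not_lt.2 h1)
  · intro k hk
    rw [hψτ] at hk
    have hc0 : c ≤ 0 := (hcφ k).trans hk.le
    have h0 : φ ((s₁ - s₀ : ℕ) : ℝ≥0∞) = 0 := le_antisymm ((hφ (hlt k).le).trans hk.le) bot_le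
    exact (hlt k).ne (((hφinv 0 hc0).2 _ h0).trans ((hφinv 0 hc0).2 _ hk).symm)
  · have hn1 : (1 : ℝ) < n := by exact_mod_cast hn
    have hdisj : Pairwise (Function.onFun Disjoint fun k : ℕ => Ioc ((s₁ : ℝ) + k) (s₁ + k + 1)) := by
      refine (pairwise_disjoint_on _).2 fun i j hij => Set.disjoint_left.2 fun y hi hj => ?_
      have : (i : ℝ) + 1 ≤ j := by exact_mod_cast hij
      linarith [hi.2, hj.1]
    refine ne_top_of_le_ne_top hiv.ne ?_
    calc ∑' k, (ψ (τ k) ^ (1 / ((n : ℝ) - 1)))⁻¹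
        ≤ ∑' k : ℕ, ∫⁻ s in Ioc ((s₁ : ℝ) + k) (s₁ + k + 1),
            (φ (ENNReal.ofReal (s - (s₀ : ℝ))) ^ (1 / ((n : ℝ) - 1)))⁻¹ := by
          refine ENNReal.tsum_le_tsum fun k => ?_
          have hvol : volume (Ioc ((s₁ : ℝ) + k) (s₁ + k + 1)) = 1 := by
            simp [Real.volume_Ioc]
          rw [← mul_one (ψ (τ k) ^ (1 / ((n : ℝ) - 1)))⁻¹, ← hvol, ← setLIntegral_const]
          refine setLIntegral_mono' measurableSet_Ioc fun s hs => ?_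
          rw [hψτ, ← hcast]
          refine ENNReal.inv_le_inv.2 (ENNReal.rpow_le_rpow
            (hφ (ENNReal.ofReal_le_ofReal ?_)) (div_nonneg zero_le_one (by linarith)))
          push_cast
          linarith [hs.2]
      _ = ∫⁻ s in ⋃ k : ℕ, Ioc ((s₁ : ℝ) + k) (s₁ + k + 1),
            (φ (ENNReal.ofReal (s - (s₀ : ℝ))) ^ (1 / ((n : ℝ) - 1)))⁻¹ :=
          (lintegral_iUnion (fun _ => measurableSet_Ioc) hdisj _).symm
      _ ≤ _ := by
          refine lintegral_mono_set (iUnion_subset fun k s hs => ?_)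
          have : (0 : ℝ) ≤ k := k.cast_nonneg
          exact lt_of_le_of_lt (by linarith) hs.1
  · intro k
    have h := hii ((p + (k + s₀) : ℕ) : ℝ) (by exact_mod_cast (by omega : s₁ ≤ p + (k + s₀)))
    rwa [show (((p + (k + s₀) : ℕ) : ℝ) - s₀) = ((p + k : ℕ) : ℝ) by push_cast; ring,
      hcast, hcast] at h
  · intro k
    have h := hiii ((p + (k + s₀) : ℕ) : ℝ) (by exact_mod_cast (by omega : s₁ + 1 ≤ p + (k + s₀)))
    rwa [show (((p + (k + s₀) : ℕ) : ℝ) + 1) = ((p + (k + s₀ + 1) : ℕ) : ℝ) by push_cast; ring,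
      hcast, hcast] at h

end Levels

section Envelope

variable {n : ℕ} {D : Set (EuclideanSpace ℝ (Fin n))} {K : ℝ}

lemma QNSubharmonicOn.erealPos_le {u : EuclideanSpace ℝ (Fin n) → EReal}
    (hu : QNSubharmonicOn K u D) {x : EuclideanSpace ℝ (Fin n)} {r : ℝ} (hr : 0 < r)
    (hxr : closedBall x r ⊆ D) :
    erealPos (u x) ≤
      ENNReal.ofReal (K / (nuBall n * r ^ n)) * ∫⁻ y in ball x r, erealPos (u y) := by
  have h := hu.2.2.2 0 le_rfl x r hr hxr
  simp_rw [erealPos_sup_neg_add] at h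
  simpa using h

lemma upperSemicontinuousOn_limsup_nhdsWithin (hD : IsOpen D)
    (w : EuclideanSpace ℝ (Fin n) → EReal) :
    UpperSemicontinuousOn (fun x => limsup w (nhdsWithin x D)) D := by
  intro x hx a ha
  obtain ⟨b, hb, hba⟩ := exists_between ha
  have h1 : ∀ᶠ y in nhds x, w y < b := by
    rw [← hD.nhdsWithin_eq hx]
    exact eventually_lt_of_limsup_lt hb
  filter_upwards [mem_nhdsWithin_of_mem_nhds h1.eventually_nhds, self_mem_nhdsWithin] with y hy hyD
  refine lt_of_le_of_lt (limsup_le_of_le (h := ?_)) hba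
  rw [hD.nhdsWithin_eq hyD]
  exact hy.mono fun _ h => h.le

lemma le_limsup_nhdsWithin {x : EuclideanSpace ℝ (Fin n)} (hx : x ∈ D)
    (w : EuclideanSpace ℝ (Fin n) → EReal) : w x ≤ limsup w (nhdsWithin x D) :=
  le_limsup_of_le (h := fun _ hb => hb.self_of_nhdsWithin hx)

/-- The mean value inequality passes to the regularized upper envelope. -/
lemma erealPos_limsup_iSup_le (hK : 1 ≤ K)
    {𝓕 : Set (EuclideanSpace ℝ (Fin n) → EReal)} (h𝓕 : ∀ u ∈ 𝓕, QNSubharmonicOn K u D)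
    {W : EuclideanSpace ℝ (Fin n) → EReal}
    (hW : W = fun x => limsup (fun y => ⨆ u ∈ 𝓕, (u y ⊔ 0)) (nhdsWithin x D))
    (hW0 : ∀ x ∈ D, 0 ≤ W x) {M : ℝ} (hM : 0 ≤ M)
    {x : EuclideanSpace ℝ (Fin n)} {r : ℝ} (hr : 0 < r) (hxr : closedBall x r ⊆ D) :
    erealPos ((W x ⊔ ((-M : ℝ) : EReal)) + (M : EReal)) ≤
      ENNReal.ofReal (K / (nuBall n * r ^ n)) *
        ∫⁻ y in ball x r, erealPos ((W y ⊔ ((-M : ℝ) : EReal)) + (M : EReal)) := by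
  have hK0 : 0 < K := by linarith
  set G : EReal → ℝ≥0∞ := fun a => erealPos ((a ⊔ ((-M : ℝ) : EReal)) + (M : EReal)) with hG
  set J := ∫⁻ y in ball x r, G (W y) with hJ
  have hGmono : Monotone G := fun a b hab => EReal.toENNReal_le_toENNReal (by gcongr)
  have hG0 : G 0 = ENNReal.ofReal M := by
    simp only [hG]
    rw [erealPos_sup_neg_add, zero_add, erealPos_eq_toENNReal, EReal.real_coe_toENNReal]
  have hpos : 0 < nuBall n * r ^ n := mul_pos nuBall_pos (pow_pos hr n)
  rcases eq_or_ne J ⊤ with hJtop | hJtop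
  · rw [hJtop, ENNReal.mul_top (ENNReal.ofReal_pos.2 (by positivity)).ne']
    exact le_top
  have hsmall : ∀ ρ, 0 < ρ → ρ < r →
      G (W x) ≤ ENNReal.ofReal (K / (nuBall n * ρ ^ n)) * J := by
    intro ρ hρ hρr
    rw [erealPos_sup_neg_add_le_iff, hW]
    refine limsup_le_of_le (h := ?_)
    filter_upwards [mem_nhdsWithin_of_mem_nhds (ball_mem_nhds x (sub_pos.2 hρr))] with y hy
    have hyr : closedBall y ρ ⊆ closedBall x r :=
      closedBall_subset_closedBall' (by rw [mem_ball] at hy; linarith)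
    have hyr' : ball y ρ ⊆ ball x r := ball_subset_ball' (by rw [mem_ball] at hy; linarith)
    refine iSup₂_le fun u hu => sup_le ?_ ?_
    · rw [← erealPos_sup_neg_add_le_iff]
      refine ((h𝓕 u hu).2.2.2 M hM y ρ hρ (hyr.trans hxr)).trans ?_
      gcongr
      refine (lintegral_mono_set hyr').trans
        (setLIntegral_mono' measurableSet_ball fun z hz => hGmono ?_)
      rw [hW]
      exact (le_sup_left.trans (le_iSup₂ (f := fun u (_ : u ∈ 𝓕) => u z ⊔ 0) u hu)).trans
        (le_limsup_nhdsWithin (hxr (ball_subset_closedBall hz))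
          fun y => ⨆ u ∈ 𝓕, (u y ⊔ 0))
    · rw [← erealPos_sup_neg_add_le_iff]
      change G 0 ≤ _
      calc G 0 ≤ ENNReal.ofReal K * ENNReal.ofReal M := by
            rw [hG0]
            exact le_mul_of_one_le_left' (by simpa using hK)
        _ = ENNReal.ofReal (K / (nuBall n * ρ ^ n)) * ∫⁻ z in ball y ρ, ENNReal.ofReal M := by
            rw [setLIntegral_const, ← ofReal_div_mul_volume_ball y hρ hK0.le]
            ring
        _ ≤ _ := by
            gcongr
            refine (lintegral_mono_set hyr').trans
              (setLIntegral_mono' measurableSet_ball fun z hz => ?_)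
            rw [← hG0]
            exact hGmono (hW0 z (hxr (ball_subset_closedBall hz)))
  have hlim : Tendsto (fun ρ : ℝ => ENNReal.ofReal (K / (nuBall n * ρ ^ n)) * J)
      (nhdsWithin r (Iio r)) (nhds (ENNReal.ofReal (K / (nuBall n * r ^ n)) * J)) := by
    refine ENNReal.Tendsto.mul_const (ENNReal.tendsto_ofReal ?_) (Or.inr hJtop)
    have : ContinuousAt (fun ρ : ℝ => K / (nuBall n * ρ ^ n)) r :=
      ContinuousAt.div continuousAt_const (by fun_prop) hpos.ne'
    exact this.tendsto.mono_left nhdsWithin_le_nhds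
  refine ge_of_tendsto hlim ?_
  filter_upwards [Ioo_mem_nhdsLT hr] with ρ hρ using hsmall ρ hρ.1 hρ.2

lemma measurable_restrict_of_upperSemicontinuousOn {u : EuclideanSpace ℝ (Fin n) → EReal}
    (hu : UpperSemicontinuousOn u D) : Measurable (D.domRestrict u) :=
  (upperSemicontinuousOn_iff_restrict.2 hu).measurable

lemma posPartLocInt_of_upperSemicontinuousOn {u : EuclideanSpace ℝ (Fin n) → EReal}
    (hu : UpperSemicontinuousOn u D) (hu' : ∀ x ∈ D, u x < ⊤) : PosPartLocInt u D := by
  intro E hED hE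
  refine hE.induction_on (p := fun s => ∫⁻ x in s, erealPos (u x) < ⊤) (by simp)
    (fun s t hst ht => (lintegral_mono_set hst).trans_lt ht)
    (fun s t hs ht => (lintegral_union_le _ s t).trans_lt (ENNReal.add_lt_top.2 ⟨hs, ht⟩)) ?_
  intro x hx
  obtain ⟨b, hb, hb'⟩ := exists_between (hu' x (hED hx))
  have h1 := (hu x (hED hx) b hb).filter_mono (nhdsWithin_mono x hED)
  obtain ⟨ε, hε, hεb⟩ := Metric.mem_nhdsWithin_iff.1 h1
  refine ⟨ball x ε ∩ E, inter_comm E _ ▸ inter_mem_nhdsWithin E (ball_mem_nhds x hε), ?_⟩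
  calc ∫⁻ y in ball x ε ∩ E, erealPos (u y) ≤ ∫⁻ y in ball x ε ∩ E, erealPos b :=
        setLIntegral_mono' (measurableSet_ball.inter hE.measurableSet) fun y hy =>
          EReal.toENNReal_le_toENNReal (le_of_lt (hεb hy))
    _ = erealPos b * volume (ball x ε ∩ E) := setLIntegral_const _ _
    _ < ⊤ := ENNReal.mul_lt_top (lt_top_iff_ne_top.2 (EReal.toENNReal_ne_top_iff.2 hb'.ne))
        ((measure_mono inter_subset_left).trans_lt measure_ball_lt_top)

end Envelope

theorem main_theorem_domination
    (n : ℕ) (hn : 2 ≤ n)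
    (D : Set (EuclideanSpace ℝ (Fin n))) (hDopen : IsOpen D) (hDconn : IsConnected D)
    (K : ℝ) (hK : 1 ≤ K)
    (φ ψ φinv ψinv : ℝ≥0∞ → ℝ≥0∞) (hφ : Monotone φ) (hψ : Monotone ψ)
    (s₀ s₁ : ℕ) (hs : s₀ < s₁)
    (hφinv : ∀ t : ℝ≥0∞, min (φ ((s₁ - s₀ : ℕ) : ℝ≥0∞)) (ψ ((s₁ - s₀ : ℕ) : ℝ≥0∞)) ≤ t →
      φ (φinv t) = t ∧ ∀ s, φ s = t → s = φinv t)
    (hψinv : ∀ t : ℝ≥0∞, min (φ ((s₁ - s₀ : ℕ) : ℝ≥0∞)) (ψ ((s₁ - s₀ : ℕ) : ℝ≥0∞)) ≤ t →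
      ψ (ψinv t) = t ∧ ∀ s, ψ s = t → s = ψinv t)
    (hii : ∀ s : ℝ, (s₁ : ℝ) ≤ s →
      ENNReal.ofReal (2 * K) * ψinv (φ (ENNReal.ofReal (s - (s₀ : ℝ)))) ≤
        ψinv (φ (ENNReal.ofReal s)))
    (hiii : ∃ C : ℝ≥0∞, C ≠ ⊤ ∧ ∀ s : ℝ, (s₁ : ℝ) + 1 ≤ s →
      ψinv (φ (ENNReal.ofReal (s + 1))) ≤ C * ψinv (φ (ENNReal.ofReal s)))
    (hiv : ∫⁻ s in Set.Ioi ((s₁ : ℝ)),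
      (φ (ENNReal.ofReal (s - (s₀ : ℝ))) ^ (1 / ((n : ℝ) - 1)))⁻¹ < ⊤)
    (F : EuclideanSpace ℝ (Fin n) → ℝ≥0∞) (hFmeas : Measurable (D.restrict F))
    (𝓕 : Set (EuclideanSpace ℝ (Fin n) → EReal)) (h𝓕ne : 𝓕.Nonempty)
    (h𝓕 : ∀ u ∈ 𝓕, QNSubharmonicOn K u D ∧ ∀ x ∈ D, u x ≤ ((F x : ℝ≥0∞) : EReal))
    (hint : ∀ E ⊆ D, IsCompact E → ∫⁻ x in E, ψ (F x) < ⊤) :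
    (∀ x ∈ D, ∃ r > (0 : ℝ), ∃ C : ℝ, ∀ y ∈ closedBall x r ∩ D, ∀ u ∈ 𝓕, u y ≤ (C : EReal)) ∧
    (∀ x ∈ D, 0 ≤ Filter.limsup (fun y => ⨆ u ∈ 𝓕, (u y ⊔ 0)) (nhdsWithin x D)) ∧
    QNSubharmonicOn K (fun x => Filter.limsup (fun y => ⨆ u ∈ 𝓕, (u y ⊔ 0)) (nhdsWithin x D)) D := by
  obtain ⟨C, hC, hiii⟩ := hiii
  have hK0 : 0 ≤ K := by linarith
  obtain ⟨τ, hτ, hτtop, hτunbdd, hψτ0, hsum, hdouble, hgrowth⟩ :=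
    exists_levels hn hφ hψ hs hφinv hψinv hii hiii hiv
  have hbdd : ∀ x ∈ D, ∃ r > (0 : ℝ), ∃ C : ℝ, ∀ y ∈ closedBall x r ∩ D, ∀ u ∈ 𝓕,
      u y ≤ (C : EReal) := by
    intro x hx
    obtain ⟨ε, hε, hεD⟩ := nhds_basis_closedBall.mem_iff.1 (hDopen.mem_nhds hx)
    have hsub : closedBall x (3 * (ε / 3)) ⊆ D := by rwa [mul_div_cancel₀ _ three_ne_zero]
    obtain ⟨m, hm⟩ := exists_forall_le_of_domination hn hK0 (Φ := fun k => ψ (τ k)) hC hτ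
      hτunbdd (hψ.comp hτ) hψτ0 (fun k => map_ne_top_of_inverse hψ hψinv (hτtop k)) hsum hdouble
      hgrowth (div_pos hε three_pos) (hint _ hsub (isCompact_closedBall _ _)).ne
    refine ⟨ε / 3, by positivity, (τ m).toReal, fun y hy u hu => ?_⟩
    obtain ⟨hqns, huF⟩ := h𝓕 u hu
    rw [← EReal.coe_toENNReal (x := ((τ m).toReal : EReal))
      (by exact_mod_cast ENNReal.toReal_nonneg), EReal.real_coe_toENNReal,
      ENNReal.ofReal_toReal (hτtop m), ← erealPos_le_iff]
    refine hm (fun y => erealPos (u y)) ?_ (fun z hz k hk => ?_)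
      (hqns.2.2.1 _ hsub (isCompact_closedBall _ _)).ne
      (fun z ρ hρ hzρ => hqns.erealPos_le hρ (hzρ.trans hsub)) y hy.1
    · exact (hqns.1.comp (measurable_inclusion hsub)).ereal_toENNReal
    · exact hψ (hk.le.trans (erealPos_le_iff.2 (huF z (hsub hz))))
  set W : EuclideanSpace ℝ (Fin n) → EReal :=
    fun x => limsup (fun y => ⨆ u ∈ 𝓕, (u y ⊔ 0)) (nhdsWithin x D) with hW
  have hW0 : ∀ x ∈ D, 0 ≤ W x := fun x hx => by
    obtain ⟨u, hu⟩ := h𝓕ne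
    exact (le_sup_right.trans (le_iSup₂ (f := fun u (_ : u ∈ 𝓕) => u x ⊔ 0) u hu)).trans
      (le_limsup_nhdsWithin hx fun y => ⨆ u ∈ 𝓕, (u y ⊔ 0))
  have hWusc : UpperSemicontinuousOn W D := upperSemicontinuousOn_limsup_nhdsWithin hDopen _
  have hWtop : ∀ x ∈ D, W x < ⊤ := fun x hx => by
    obtain ⟨r, hr, C, hC⟩ := hbdd x hx
    refine lt_of_le_of_lt (limsup_le_of_le (h := ?_)) (EReal.coe_lt_top (C ⊔ 0))
    filter_upwards [self_mem_nhdsWithin,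
      mem_nhdsWithin_of_mem_nhds (closedBall_mem_nhds x hr)] with y hyD hy
    exact iSup₂_le fun u hu => sup_le
      ((hC y ⟨hy, hyD⟩ u hu).trans (by exact_mod_cast le_sup_left))
      (by exact_mod_cast le_sup_right)
  exact ⟨hbdd, hW0, measurable_restrict_of_upperSemicontinuousOn hWusc, hWtop,
    posPartLocInt_of_upperSemicontinuousOn hWusc hWtop, fun M hM x r hr hxr =>
      erealPos_limsup_iSup_le hK (fun u hu => (h𝓕 u hu).1) hW hW0 hM hr hxr⟩
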